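/- Pea-to-sun consequence of the Banach–Tarski paradox: for any two radii 0 < r < R, the closed ball of radius r in ℝ³ is equidecomposable with the closed ball of radius R; that is, a pea can be split into finitely many pieces which, after being moved by isometries, reassemble into a solid ball of arbitrarily large diameter. -/

import Mathlib

/-- Two subsets `X, Y` of `ℝ³` are *equidecomposable* if there are a positive number `n`
of pairwise disjoint pieces `A 1, …, A n` partitioning `X` and isometries `g 1, …, g n`
of `ℝ³` such that the images `g i '' A i` are pairwise disjoint with union `Y`. -/
def Equidecomposable (X Y : Set (EuclideanSpace ℝ (Fin 3))) : Prop :=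
  ∃ n : ℕ, 0 < n ∧
    ∃ (A : Fin n → Set (EuclideanSpace ℝ (Fin 3)))
      (g : Fin n → (EuclideanSpace ℝ (Fin 3) ≃ᵢ EuclideanSpace ℝ (Fin 3))),
      (∀ i j, i ≠ j → Disjoint (A i) (A j)) ∧
      X = ⋃ i, A i ∧
      (∀ i j, i ≠ j → Disjoint (g i '' A i) (g j '' A j)) ∧
      Y = ⋃ i, g i '' A i

section PiecewiseIsometry

variable {α : Type*} [PseudoEMetricSpace α]

/-- `f` agrees at each point of `X` with one of finitely many isometries. -/
def PiecewiseIsometryOn (f : α → α) (X : Set α) : Prop :=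
  ∃ S : Set (α ≃ᵢ α), S.Finite ∧ ∀ x ∈ X, ∃ g ∈ S, g x = f x

theorem piecewiseIsometryOn_id (X : Set α) : PiecewiseIsometryOn id X :=
  ⟨{1}, Set.finite_singleton _, fun _ _ => ⟨1, rfl, rfl⟩⟩

theorem PiecewiseIsometryOn.comp {f f' : α → α} {X Y : Set α} (hf' : PiecewiseIsometryOn f' Y)
    (hf : PiecewiseIsometryOn f X) (hXY : Set.MapsTo f X Y) : PiecewiseIsometryOn (f' ∘ f) X := by
  obtain ⟨S, hS, h⟩ := hf
  obtain ⟨T, hT, h'⟩ := hf'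
  refine ⟨Set.image2 (fun a b => a * b) T S, hT.image2 _ hS, fun x hx => ?_⟩
  obtain ⟨g, hg, hgx⟩ := h x hx
  obtain ⟨g', hg', hgx'⟩ := h' (f x) (hXY hx)
  exact ⟨g' * g, ⟨g', hg', g, hg, rfl⟩, by simp [IsometryEquiv.mul_apply, hgx, hgx']⟩

theorem PiecewiseIsometryOn.iterate {f : α → α} {X : Set α} (hf : PiecewiseIsometryOn f X)
    (hX : Set.MapsTo f X X) (n : ℕ) : PiecewiseIsometryOn f^[n] X := by
  induction n with
  | zero => exact piecewiseIsometryOn_id X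
  | succ n ih => exact ih.comp hf hX

/-- `X` contains two disjoint piecewise isometric copies of itself. -/
def IsParadoxical (X : Set α) : Prop :=
  ∃ p : Bool → α → α, (∀ b, PiecewiseIsometryOn (p b) X) ∧ (∀ b, Set.MapsTo (p b) X X) ∧
    (∀ b, Set.InjOn (p b) X) ∧ ∀ x ∈ X, ∀ y ∈ X, p false x ≠ p true y

theorem IsParadoxical.exists_copies {X : Set α} (hX : IsParadoxical X) :
    ∃ q : ℕ → α → α, (∀ n, PiecewiseIsometryOn (q n) X) ∧ (∀ n, Set.MapsTo (q n) X X) ∧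
      ∀ m n, ∀ x ∈ X, ∀ y ∈ X, q m x = q n y → m = n ∧ x = y := by
  obtain ⟨p, hp, hm, hi, hd⟩ := hX
  have hmi (n : ℕ) : Set.MapsTo (p false)^[n] X X := (hm false).iterate n
  have hii (n : ℕ) : Set.InjOn (p false)^[n] X := (hi false).iterate (hm false) n
  have key (m k : ℕ) {x y : α} (hx : x ∈ X) (hy : y ∈ X)
      (h : (p false)^[m] (p true x) = (p false)^[m + k] (p true y)) : k = 0 := by
    rw [Function.iterate_add_apply] at h
    have h' := hii m (hm true hx) (hmi k (hm true hy)) h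
    cases k with
    | zero => rfl
    | succ k =>
      rw [Function.iterate_succ_apply'] at h'
      exact absurd h'.symm (hd _ (hmi k (hm true hy)) x hx)
  refine ⟨fun n => (p false)^[n] ∘ p true,
    fun n => ((hp false).iterate (hm false) n).comp (hp true) (hm true),
    fun n => (hmi n).comp (hm true), fun m n x hx y hy h => ?_⟩
  obtain rfl : m = n := by
    rcases le_total m n with hmn | hmn
    · obtain ⟨k, rfl⟩ := Nat.exists_eq_add_of_le hmn
      simp [key m k hx hy h]
    · obtain ⟨k, rfl⟩ := Nat.exists_eq_add_of_le hmn
      simp [key n k hy hx h.symm]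
  exact ⟨rfl, hi true hx hy (hii m (hm true hx) (hm true hy) h)⟩

/-- A set covered by finitely many isometric copies of a paradoxical set `X` embeds piecewise
isometrically into `X`. -/
theorem IsParadoxical.exists_injOn_of_cover {X Y : Set α} (hX : IsParadoxical X)
    {T : Set (α ≃ᵢ α)} (hT : T.Finite) (hY : ∀ y ∈ Y, ∃ g ∈ T, g y ∈ X) :
    ∃ f : α → α, PiecewiseIsometryOn f Y ∧ Set.MapsTo f Y X ∧ Set.InjOn f Y := by
  classical
  obtain ⟨q, hq, hm, hi⟩ := hX.exists_copies
  choose S hS hSq using hq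
  obtain ⟨e, he⟩ := hT.countable.exists_injective_nat'
  choose! g hgT hgX using hY
  let c : (α ≃ᵢ α) → ℕ := fun a => if h : a ∈ T then e ⟨a, h⟩ else 0
  have hc {a b} (ha : a ∈ T) (hb : b ∈ T) (h : c a = c b) : a = b := by
    simp only [c, ha, hb, dif_pos] at h
    exact congrArg Subtype.val (he h)
  refine ⟨fun y => q (c (g y)) (g y y), ⟨⋃ a ∈ T, (fun s => s * a) '' S (c a),
    hT.biUnion fun a _ => (hS _).image _, fun y hy => ?_⟩, fun y hy => hm _ (hgX y hy),
    fun y hy z hz h => ?_⟩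
  · obtain ⟨s, hs, hsy⟩ := hSq (c (g y)) _ (hgX y hy)
    exact ⟨s * g y, Set.mem_biUnion (hgT y hy) ⟨s, hs, rfl⟩, hsy⟩
  · obtain ⟨h₁, h₂⟩ := hi _ _ _ (hgX y hy) _ (hgX z hz) h
    rw [hc (hgT y hy) (hgT z hz) h₁] at h₂
    exact (g z).injective h₂

end PiecewiseIsometry

theorem equidecomposable_of_injOn {X Y : Set (EuclideanSpace ℝ (Fin 3))}
    {f f' : EuclideanSpace ℝ (Fin 3) → EuclideanSpace ℝ (Fin 3)}
    (hf : PiecewiseIsometryOn f X) (hfm : Set.MapsTo f X Y) (hfi : Set.InjOn f X)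
    (hf' : PiecewiseIsometryOn f' Y) (hfm' : Set.MapsTo f' Y X) (hfi' : Set.InjOn f' Y) :
    Equidecomposable X Y := by
  obtain ⟨S, hS, h⟩ := hf
  obtain ⟨S', hS', h'⟩ := hf'
  let T : Set (EuclideanSpace ℝ (Fin 3) ≃ᵢ EuclideanSpace ℝ (Fin 3)) :=
    insert 1 (S ∪ (fun a => a⁻¹) '' S')
  have hT : T.Finite := (hS.union (hS'.image _)).insert 1
  obtain ⟨k, hk, hkT⟩ := Function.Embedding.schroeder_bernstein_of_rel
    ((Set.MapsTo.restrict_inj hfm).2 hfi) ((Set.MapsTo.restrict_inj hfm').2 hfi')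
    (fun a b => ∃ g ∈ T, g a = b)
    (fun a => by
      obtain ⟨g, hg, hga⟩ := h a a.2
      exact ⟨g, Or.inr (Or.inl hg), hga⟩)
    (fun b => by
      obtain ⟨g, hg, hgb⟩ := h' b b.2
      refine ⟨g⁻¹, Or.inr (Or.inr ⟨g, hg, rfl⟩), ?_⟩
      simp [← hgb, IsometryEquiv.inv_apply_self])
  choose c hcT hc using hkT
  have : Fintype T := hT.fintype
  let e := Fintype.equivFin T
  have inj {i j : Fin (Fintype.card T)} {x y : X} (hx : e ⟨c x, hcT x⟩ = i)
      (hy : e ⟨c y, hcT y⟩ = j)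
      (hxy : (e.symm i : EuclideanSpace ℝ (Fin 3) ≃ᵢ EuclideanSpace ℝ (Fin 3)) x =
        (e.symm j : EuclideanSpace ℝ (Fin 3) ≃ᵢ EuclideanSpace ℝ (Fin 3)) y) : i = j := by
    subst hx hy
    simp only [Equiv.symm_apply_apply, hc] at hxy
    rw [hk.1 (Subtype.ext hxy)]
  refine ⟨Fintype.card T, Fintype.card_pos_iff.2 ⟨⟨1, Or.inl rfl⟩⟩,
    fun i => (fun x : X => (x : EuclideanSpace ℝ (Fin 3))) '' {x | e ⟨c x, hcT x⟩ = i},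
    fun i => (e.symm i).1, fun i j hij => ?_, ?_, fun i j hij => ?_, ?_⟩
  · rw [Set.disjoint_left]
    rintro _ ⟨x, hx, rfl⟩ ⟨y, hy, hxy⟩
    obtain rfl := Subtype.ext hxy
    exact hij (hx.symm.trans hy)
  · ext x
    simp
  · rw [Set.disjoint_left]
    rintro _ ⟨_, ⟨x, hx, rfl⟩, rfl⟩ ⟨_, ⟨y, hy, rfl⟩, hxy⟩
    exact hij (inj hx hy hxy.symm)
  · ext y
    simp only [Set.mem_iUnion]
    constructor
    · intro hy
      obtain ⟨x, hx⟩ := hk.2 ⟨y, hy⟩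
      refine ⟨e ⟨c x, hcT x⟩, x, ⟨x, rfl, rfl⟩, ?_⟩
      simp [hc, hx]
    · rintro ⟨i, _, ⟨x, rfl, rfl⟩, rfl⟩
      simp [hc]

namespace FreeGroup

theorem head?_toWord_inv_mul {α : Type*} [DecidableEq α] (a : α) {w : FreeGroup α}
    (hw : w.toWord.head? ≠ some (a, true)) :
    ((of a)⁻¹ * w).toWord.head? = some (a, false) := by
  have h : ((of a)⁻¹ * w).toWord = reduce ((a, false) :: w.toWord) := by
    rw [toWord_mul, toWord_inv, toWord_of]
    rfl
  rw [h, reduce.cons, reduce_toWord]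
  revert hw
  rcases w.toWord with _ | ⟨⟨b, ε⟩, L⟩
  · simp
  · cases ε <;> simp +contextual [eq_comm]

end FreeGroup

theorem isParadoxical_of_free {α : Type*} [PseudoEMetricSpace α]
    (θ : FreeGroup Bool →* (α ≃ᵢ α)) {X : Set α} (hX : ∀ g, Set.MapsTo (θ g) X X)
    (hfree : ∀ g, ∀ x ∈ X, θ g x = x → g = 1) : IsParadoxical X := by
  classical
  -- a map to the group that is equivariant on `X`
  obtain ⟨τ, hτ⟩ : ∃ τ : α → FreeGroup Bool, ∀ g, ∀ x ∈ X, τ (θ g x) = g * τ x := by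
    let s : Setoid α :=
      { r := fun x y => ∃ g, θ g x = y
        iseqv :=
          { refl := fun x => ⟨1, by simp⟩
            symm := by
              rintro x _ ⟨g, rfl⟩
              exact ⟨g⁻¹, by simp⟩
            trans := by
              rintro x _ _ ⟨g, rfl⟩ ⟨h, rfl⟩
              exact ⟨h * g, by simp [IsometryEquiv.mul_apply]⟩ } }
    have hs (x : α) : ∃ g, θ g (Quotient.mk s x).out = x := Quotient.mk_out (s := s) x
    choose τ hτ using hs
    refine ⟨τ, fun g x hx => ?_⟩
    have hq : Quotient.mk s (θ g x) = Quotient.mk s x := Quotient.sound ⟨g⁻¹, by simp⟩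
    have h := hτ (θ g x)
    rw [hq] at h
    set t := (Quotient.mk s x).out
    have hxt : (θ (τ x))⁻¹ x = t := by
      have : (θ (τ x))⁻¹ (θ (τ x) t) = t := IsometryEquiv.inv_apply_self _ _
      rwa [hτ x] at this
    have ht : t ∈ X := by
      rw [← hxt, ← map_inv]
      exact hX _ hx
    have := hfree ((g * τ x)⁻¹ * τ (θ g x)) t ht (by
      rw [map_mul, IsometryEquiv.mul_apply, h, map_inv, map_mul, mul_inv_rev,
        IsometryEquiv.mul_apply, IsometryEquiv.inv_apply_self, hxt])
    exact (inv_mul_eq_one.1 this).symm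
  let s (b : Bool) (w : FreeGroup Bool) : FreeGroup Bool :=
    if w.toWord.head? = some (b, true) then 1 else (FreeGroup.of b)⁻¹
  have hs (b : Bool) (w : FreeGroup Bool) : (s b w * w).toWord.head? =
      some (b, decide (w.toWord.head? = some (b, true))) := by
    by_cases h : w.toWord.head? = some (b, true)
    · simp [s, h]
    · simp [s, h, FreeGroup.head?_toWord_inv_mul b h]
  have hsτ (b : Bool) {x : α} (hx : x ∈ X) : τ (θ (s b (τ x)) x) = s b (τ x) * τ x := hτ _ _ hx
  refine ⟨fun b x => θ (s b (τ x)) x, fun b => ?_, fun b x hx => hX _ hx, fun b x hx y hy h => ?_,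
    fun x hx y hy h => ?_⟩
  · refine ⟨{θ 1, θ (FreeGroup.of b)⁻¹}, by simp, fun x _ => ?_⟩
    by_cases h : (τ x).toWord.head? = some (b, true) <;> simp [s, h]
  · have h₁ := congrArg τ h
    simp only [hsτ b hx, hsτ b hy] at h₁
    have h₂ := congrArg (fun w => w.toWord.head?) h₁
    simp only [hs, Option.some.injEq, Prod.mk.injEq, true_and, decide_eq_decide] at h₂
    have h₃ : s b (τ x) = s b (τ y) := by simp only [s, h₂]
    simp only [h₃] at h
    exact (θ _).injective h
  · have h₁ := congrArg (fun z => (τ z).toWord.head?) h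
    simp only [hsτ _ hx, hsτ _ hy, hs] at h₁
    simp at h₁

section FreeRotations

open scoped Matrix

theorem Matrix.map_intCast_mul {n R : Type*} [Fintype n] [Ring R] (A B : Matrix n n ℤ) :
    (A * B).map (Int.cast : ℤ → R) = A.map (Int.cast : ℤ → R) * B.map (Int.cast : ℤ → R) :=
  Matrix.map_mul (f := Int.castRingHom R)

/-- Five times the rotation matrix of a letter: the rotations by `± arccos (3 / 5)` about the third
axis (generator `false`) and the first axis (generator `true`). -/
def letterMatrix : Bool × Bool → Matrix (Fin 3) (Fin 3) ℤ
  | (false, true) => !![3, -4, 0; 4, 3, 0; 0, 0, 5]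
  | (false, false) => !![3, 4, 0; -4, 3, 0; 0, 0, 5]
  | (true, true) => !![5, 0, 0; 0, 3, -4; 0, 4, 3]
  | (true, false) => !![5, 0, 0; 0, 3, 4; 0, -4, 3]

/-- A vector spanning the range of `letterMatrix l` modulo `5`. -/
def letterVector : Bool × Bool → Fin 3 → ZMod 5
  | (false, true) => ![3, 4, 0]
  | (false, false) => ![3, 1, 0]
  | (true, true) => ![0, 3, 4]
  | (true, false) => ![0, 3, 1]

theorem letterMatrix_transpose (b ε : Bool) :
    (letterMatrix (b, ε)).transpose = letterMatrix (b, !ε) := by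
  revert b ε
  decide

theorem letterMatrix_mul_transpose (l : Bool × Bool) :
    letterMatrix l * (letterMatrix l).transpose = Matrix.diagonal fun _ => 25 := by
  revert l
  decide

theorem letterMatrix_mulVec_letterVector (l m : Bool × Bool) (h : l.1 = m.1 → l.2 = m.2) :
    ∃ c : ZMod 5, c ≠ 0 ∧
      (letterMatrix l).map (Int.cast : ℤ → ZMod 5) *ᵥ letterVector m = c • letterVector l := by
  revert l m
  decide

theorem letterMatrix_mulVec_single (l : Bool × Bool) :
    ∃ c : ZMod 5, c ≠ 0 ∧
      (letterMatrix l).map (Int.cast : ℤ → ZMod 5) *ᵥ ![0, 1, 0] = c • letterVector l := by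
  revert l
  decide

theorem letterVector_ne_zero (l : Bool × Bool) : letterVector l ≠ 0 := by
  revert l
  decide

theorem prod_letterMatrix_mulVec (l : Bool × Bool) (L : List (Bool × Bool))
    (hL : FreeGroup.IsReduced (l :: L)) :
    ∃ c : ZMod 5, c ≠ 0 ∧
      (((l :: L).map letterMatrix).prod.map (Int.cast : ℤ → ZMod 5)) *ᵥ ![0, 1, 0] =
        c • letterVector l := by
  have : Fact (Nat.Prime 5) := ⟨Nat.prime_five⟩
  induction L generalizing l with
  | nil => simpa using letterMatrix_mulVec_single l
  | cons m L ih =>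
    rw [FreeGroup.isReduced_cons_cons] at hL
    obtain ⟨c, hc, h⟩ := ih m hL.2
    obtain ⟨d, hd, h'⟩ := letterMatrix_mulVec_letterVector l m hL.1
    refine ⟨c * d, mul_ne_zero hc hd, ?_⟩
    rw [List.map_cons, List.prod_cons, Matrix.map_intCast_mul, ← Matrix.mulVec_mulVec, h,
      Matrix.mulVec_smul, h', smul_smul]

/-- The rotation of `ℝ³` by `arccos (3 / 5)` about the third (`false`) or first (`true`) axis. -/
noncomputable def generatorRotation (b : Bool) : Matrix.unitaryGroup (Fin 3) ℝ :=
  ⟨(5⁻¹ : ℝ) • (letterMatrix (b, true)).map (Int.cast : ℤ → ℝ), by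
    have h := congrArg (fun A : Matrix (Fin 3) (Fin 3) ℤ => A.map (Int.cast : ℤ → ℝ))
      (letterMatrix_mul_transpose (b, true))
    rw [Matrix.mem_unitaryGroup_iff, Matrix.star_eq_conjTranspose,
      Matrix.conjTranspose_eq_transpose_of_trivial, Matrix.transpose_smul,
      Matrix.smul_mul, Matrix.mul_smul, smul_smul, ← Matrix.transpose_map,
      ← Matrix.map_intCast_mul, h]
    ext i j
    by_cases hij : i = j <;> norm_num [hij, Matrix.one_apply, Matrix.diagonal_apply]⟩

theorem coe_lift_generatorRotation (L : List (Bool × Bool)) :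
    ((FreeGroup.lift generatorRotation (FreeGroup.mk L) : Matrix.unitaryGroup (Fin 3) ℝ) :
      Matrix (Fin 3) (Fin 3) ℝ) =
      (5⁻¹ : ℝ) ^ L.length • (L.map letterMatrix).prod.map (Int.cast : ℤ → ℝ) := by
  rw [FreeGroup.lift_mk]
  induction L with
  | nil => simp
  | cons l L ih =>
    obtain ⟨b, ε⟩ := l
    have hl : ((cond ε (generatorRotation b) (generatorRotation b)⁻¹ :
        Matrix.unitaryGroup (Fin 3) ℝ) : Matrix (Fin 3) (Fin 3) ℝ) =
        (5⁻¹ : ℝ) • (letterMatrix (b, ε)).map (Int.cast : ℤ → ℝ) := by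
      cases ε
      · rw [cond_false, Matrix.UnitaryGroup.inv_val, generatorRotation,
          Matrix.star_eq_conjTranspose, Matrix.conjTranspose_eq_transpose_of_trivial,
          Matrix.transpose_smul, ← Matrix.transpose_map,
          letterMatrix_transpose, Bool.not_true]
      · rfl
    simp only [List.map_cons, List.prod_cons, Submonoid.coe_mul, List.length_cons,
      Matrix.map_intCast_mul] at ih ⊢
    rw [hl, ih, Matrix.smul_mul, Matrix.mul_smul, smul_smul, pow_succ']

theorem lift_generatorRotation_injective :
    Function.Injective (FreeGroup.lift generatorRotation) := by
  rw [injective_iff_map_eq_one]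
  intro w hw
  by_contra hw1
  rw [← FreeGroup.toWord_eq_nil_iff] at hw1
  obtain ⟨l, L, hL⟩ := List.exists_cons_of_ne_nil hw1
  have hred : FreeGroup.IsReduced (l :: L) := hL ▸ FreeGroup.isReduced_toWord
  have h := coe_lift_generatorRotation (l :: L)
  rw [← hL, FreeGroup.mk_toWord, hw, hL] at h
  have hZ : ((l :: L).map letterMatrix).prod = (5 : ℤ) ^ (l :: L).length • 1 := by
    ext i j
    have hij := congrFun₂ h i j
    simp only [Submonoid.coe_one, Matrix.smul_apply, Matrix.map_apply, smul_eq_mul, inv_pow] at hij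
    rw [eq_inv_mul_iff_mul_eq₀ (by positivity)] at hij
    have : ((5 : ℤ) ^ (l :: L).length * (1 : Matrix (Fin 3) (Fin 3) ℤ) i j : ℝ) =
        (((l :: L).map letterMatrix).prod i j : ℤ) := by
      rw [← hij]
      by_cases hij : i = j <;> simp [hij, Matrix.one_apply]
    rw [Matrix.smul_apply, smul_eq_mul]
    exact_mod_cast this.symm
  have : Fact (Nat.Prime 5) := ⟨Nat.prime_five⟩
  obtain ⟨c, hc, hcl⟩ := prod_letterMatrix_mulVec l L hred
  have h0 : ((5 : ℤ) ^ (l :: L).length • (1 : Matrix (Fin 3) (Fin 3) ℤ)).map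
      (Int.cast : ℤ → ZMod 5) = 0 := by
    ext i j
    have h5 : ((5 : ℤ) : ZMod 5) = 0 := rfl
    rw [Matrix.map_apply, Matrix.smul_apply, smul_eq_mul, Int.cast_mul, Int.cast_pow, h5,
      List.length_cons, pow_succ, mul_zero, zero_mul, Matrix.zero_apply]
  rw [hZ, h0, Matrix.zero_mulVec] at hcl
  exact smul_ne_zero hc (letterVector_ne_zero l) hcl.symm

/-- A free group of rank two acting on `ℝ³` by rotations about the origin. -/
noncomputable def freeRotations :
    FreeGroup Bool →* (EuclideanSpace ℝ (Fin 3) ≃ₗᵢ[ℝ] EuclideanSpace ℝ (Fin 3)) :=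
  (Unitary.linearIsometryEquiv.toMonoidHom.comp
    (Unitary.map (.ofClass (Matrix.toEuclideanCLM (n := Fin 3) (𝕜 := ℝ)))).toMonoidHom).comp
    (FreeGroup.lift generatorRotation)

theorem freeRotations_injective : Function.Injective freeRotations := by
  refine Unitary.linearIsometryEquiv.injective.comp
    (Function.Injective.comp (fun a b h => ?_) lift_generatorRotation_injective)
  exact Subtype.ext (Matrix.toEuclideanCLM.injective (congrArg Subtype.val h))

/-- The fixed space of a linear isometry of `ℝ³` whose square is nontrivial is at most a line. -/
theorem finrank_eqLocus_le_one (g : EuclideanSpace ℝ (Fin 3) ≃ₗᵢ[ℝ] EuclideanSpace ℝ (Fin 3))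
    (hg : g ^ 2 ≠ 1) :
    Module.finrank ℝ (LinearMap.eqLocus (g : EuclideanSpace ℝ (Fin 3) →ₗ[ℝ] _) LinearMap.id) ≤
      1 := by
  set K := LinearMap.eqLocus (g : EuclideanSpace ℝ (Fin 3) →ₗ[ℝ] _) LinearMap.id with hKdef
  have hK {x} (hx : x ∈ K) : g x = x := hx
  by_contra! hlt
  have hsum := K.finrank_add_finrank_orthogonal
  rw [finrank_euclideanSpace_fin] at hsum
  obtain ⟨v, hv⟩ := finrank_le_one_iff.1 (show Module.finrank ℝ Kᗮ ≤ 1 by omega)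
  have hgperp (w : EuclideanSpace ℝ (Fin 3)) (hw : w ∈ Kᗮ) : g w ∈ Kᗮ := by
    intro x hx
    rw [← hK hx, g.inner_map_map]
    exact hw x hx
  obtain ⟨c, hc⟩ := hv ⟨g v, hgperp v v.2⟩
  have hc' : g v = c • (v : EuclideanSpace ℝ (Fin 3)) := (congrArg Subtype.val hc).symm
  have hggv : g (g v) = v := by
    by_cases hv0 : (v : EuclideanSpace ℝ (Fin 3)) = 0
    · simp [hv0]
    · have hn := g.norm_map v
      rw [hc', norm_smul] at hn
      have hc1 : ‖c‖ = 1 := mul_right_cancel₀ (norm_ne_zero_iff.2 hv0) (hn.trans (one_mul _).symm)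
      have hcc : c * c = 1 := by
        rw [← abs_mul_abs_self, ← Real.norm_eq_abs, hc1, one_mul]
      rw [hc', map_smul, hc', smul_smul, hcc, one_smul]
  refine hg (LinearIsometryEquiv.ext fun z => ?_)
  obtain ⟨k, hk, w, hw, rfl⟩ := K.exists_add_mem_mem_orthogonal z
  obtain ⟨d, hd⟩ := hv ⟨w, hw⟩
  have hd' : w = d • (v : EuclideanSpace ℝ (Fin 3)) := (congrArg Subtype.val hd).symm
  change g (g (k + w)) = k + w
  rw [map_add, map_add, hK hk, hK hk, hd', map_smul, map_smul, hggv]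

/-- The points of `ℝ³` moved by every nontrivial element of `freeRotations`. -/
def freePoints : Set (EuclideanSpace ℝ (Fin 3)) :=
  {x | ∀ g, freeRotations g x = x → g = 1}

theorem freeRotations_mem_freePoints (g : FreeGroup Bool) {x : EuclideanSpace ℝ (Fin 3)}
    (hx : x ∈ freePoints) : freeRotations g x ∈ freePoints := by
  intro h hgx
  have := hx (g⁻¹ * h * g) (by
    rw [map_mul, map_mul, map_inv]
    change (freeRotations g).symm (freeRotations h (freeRotations g x)) = x
    rw [hgx, LinearIsometryEquiv.symm_apply_apply])
  simpa [mul_assoc, inv_mul_eq_one] using this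

theorem isParadoxical_closedBall_inter_freePoints (r : ℝ) :
    IsParadoxical (Metric.closedBall (0 : EuclideanSpace ℝ (Fin 3)) r ∩ freePoints) := by
  let ι : (EuclideanSpace ℝ (Fin 3) ≃ₗᵢ[ℝ] EuclideanSpace ℝ (Fin 3)) →*
      (EuclideanSpace ℝ (Fin 3) ≃ᵢ EuclideanSpace ℝ (Fin 3)) :=
    { toFun := fun g => g.toIsometryEquiv
      map_one' := rfl
      map_mul' := fun _ _ => rfl }
  refine isParadoxical_of_free (ι.comp freeRotations)
    (fun g x hx => ⟨?_, freeRotations_mem_freePoints g hx.2⟩) fun g x hx => hx.2 g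
  rw [mem_closedBall_zero_iff]
  exact ((freeRotations g).norm_map x).trans_le (mem_closedBall_zero_iff.1 hx.1)

/-- Arbitrarily small translations move every point outside `freePoints` into `freePoints`. -/
theorem exists_add_mem_freePoints {ε : ℝ} (hε : 0 < ε) :
    ∃ v : EuclideanSpace ℝ (Fin 3), ‖v‖ < ε ∧ ∀ x ∉ freePoints, x + v ∈ freePoints := by
  let K (g : FreeGroup Bool) : Submodule ℝ (EuclideanSpace ℝ (Fin 3)) :=
    LinearMap.eqLocus (freeRotations g : EuclideanSpace ℝ (Fin 3) →ₗ[ℝ] _) LinearMap.id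
  have hK (g) (hg : g ≠ 1) : Module.finrank ℝ (K g) ≤ 1 := by
    refine finrank_eqLocus_le_one _ ?_
    rw [← map_pow]
    exact (map_ne_one_iff _ freeRotations_injective).2 (by simpa using hg)
  let U : Set (EuclideanSpace ℝ (Fin 3)) :=
    ⋃ p : {p : FreeGroup Bool × FreeGroup Bool // p.1 ≠ 1 ∧ p.2 ≠ 1},
      (K p.1.1 ⊔ K p.1.2 : Submodule ℝ _)
  have : Countable (FreeGroup Bool) := FreeGroup.toWord_injective.countable
  have hU : MeasureTheory.volume U = 0 := by
    refine MeasureTheory.measure_iUnion_null fun p =>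
      MeasureTheory.Measure.addHaar_submodule _ _ fun htop => ?_
    have h₁ := Submodule.finrank_add_le_finrank_add_finrank (K p.1.1) (K p.1.2)
    rw [htop, finrank_top, finrank_euclideanSpace_fin] at h₁
    have h₂ := hK _ p.2.1
    have h₃ := hK _ p.2.2
    omega
  obtain ⟨v, hv, hvU⟩ : ∃ v ∈ Metric.ball (0 : EuclideanSpace ℝ (Fin 3)) ε, v ∉ U := by
    by_contra! h
    exact (Metric.measure_ball_pos MeasureTheory.volume _ hε).ne'
      (MeasureTheory.measure_mono_null h hU)
  refine ⟨v, mem_ball_zero_iff.1 hv, fun x hx => ?_⟩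
  simp only [freePoints, Set.mem_ofPred_eq, not_forall] at hx
  obtain ⟨g, hgx, hg⟩ := hx
  intro h hxv
  by_contra hh
  refine hvU (Set.mem_iUnion.2 ⟨⟨(h, g), hh, hg⟩, ?_⟩)
  have hxK : x ∈ K g := hgx
  have hxvK : x + v ∈ K h := hxv
  simpa using Submodule.sub_mem_sup hxvK hxK

end FreeRotations

/-- **Pea-to-sun paradox**: for any radii `0 < r < R`, the closed ball of radius `r`
in `ℝ³` is equidecomposable with the closed ball of radius `R`. -/
theorem pea_to_sun (r R : ℝ) (hr : 0 < r) (hrR : r < R) :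
    Equidecomposable (Metric.closedBall (0 : EuclideanSpace ℝ (Fin 3)) r)
      (Metric.closedBall (0 : EuclideanSpace ℝ (Fin 3)) R) := by
  obtain ⟨v, hv, hvx⟩ := exists_add_mem_freePoints (half_pos hr)
  obtain ⟨t, -, ht, hcover⟩ :=
    (isCompact_closedBall (0 : EuclideanSpace ℝ (Fin 3)) R).finite_cover_balls (half_pos hr)
  obtain ⟨f, hf, hfm, hfi⟩ :=
    (isParadoxical_closedBall_inter_freePoints r).exists_injOn_of_cover
      (Y := Metric.closedBall 0 R)
      (T := (fun c => IsometryEquiv.addRight (-c)) '' t ∪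
        (fun c => IsometryEquiv.addRight (-c + v)) '' t)
      ((ht.image _).union (ht.image _)) (fun y hy => by
        obtain ⟨c, hc, hyc⟩ := Set.mem_iUnion₂.1 (hcover hy)
        rw [mem_ball_iff_norm, sub_eq_add_neg] at hyc
        by_cases hfree : y + -c ∈ freePoints
        · refine ⟨_, Or.inl ⟨c, hc, rfl⟩, ?_, hfree⟩
          rw [mem_closedBall_zero_iff]
          change ‖y + -c‖ ≤ r
          linarith
        · refine ⟨_, Or.inr ⟨c, hc, rfl⟩, ?_, ?_⟩
          · rw [mem_closedBall_zero_iff]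
            change ‖y + (-c + v)‖ ≤ r
            rw [← add_assoc]
            linarith [norm_add_le (y + -c) v]
          · change y + (-c + v) ∈ freePoints
            rw [← add_assoc]
            exact hvx _ hfree)
  exact equidecomposable_of_injOn (piecewiseIsometryOn_id _)
    (fun x hx => Metric.closedBall_subset_closedBall hrR.le hx) (Set.injOn_id _) hf
    (fun y hy => (hfm hy).1) hfi
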